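/- arXiv:1907.11535 — 2 statements merged into one kernel-verified Lean document; each statement's English description precedes it below -/
import Mathlib

section
/- Let T > 0 and let ū and u_ be C^{2,1} functions on [-1,1]×[0,T] such that ū is an upper solution of problem (B) and u_ is a lower solution of problem (B). If u_(x,0) ≤ ū(x,0) for all x ∈ [-1,1], then u_(x,t) ≤ ū(x,t) for all x ∈ [-1,1] and t ∈ [0,T]. -/
open Real

/-- Partial derivative in `x` of a function `u(x,t)`. -/
noncomputable def ux (u : ℝ → ℝ → ℝ) (x t : ℝ) : ℝ := deriv (fun y => u y t) x

/-- Second partial derivative in `x` of a function `u(x,t)`. -/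
noncomputable def uxx (u : ℝ → ℝ → ℝ) (x t : ℝ) : ℝ := deriv (fun y => ux u y t) x

/-- Partial derivative in `t` of a function `u(x,t)`. -/
noncomputable def ut (u : ℝ → ℝ → ℝ) (x t : ℝ) : ℝ := deriv (fun s => u x s) t

/-- A `C^{2,1}` function on the rectangle `[-1,1] × [0,T]`: `u` and `u_x` are
continuous on the closed rectangle, and `u` is twice differentiable in `x`
and once differentiable in `t` for `t ∈ (0,T]`. -/
def C21Rect (u : ℝ → ℝ → ℝ) (T : ℝ) : Prop :=
  ContinuousOn (fun p : ℝ × ℝ => u p.1 p.2) (Set.Icc (-1 : ℝ) 1 ×ˢ Set.Icc (0 : ℝ) T) ∧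
  ContinuousOn (fun p : ℝ × ℝ => ux u p.1 p.2) (Set.Icc (-1 : ℝ) 1 ×ˢ Set.Icc (0 : ℝ) T) ∧
  ∀ t ∈ Set.Ioc (0 : ℝ) T, ∀ x ∈ Set.Icc (-1 : ℝ) 1,
    DifferentiableAt ℝ (fun y => u y t) x ∧
    DifferentiableAt ℝ (fun y => ux u y t) x ∧
    DifferentiableAt ℝ (fun s => u x s) t

/-- An upper solution of problem (B) on `[-1,1] × [0,T]`:
`ū_t ≥ ū_xx/(1+ū_x²)` on `(-1,1) × (0,T]`, with `ū_x(1,t) ≥ ū(1,t)` and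
`ū_x(-1,t) ≤ -ū(-1,t)` for `t ∈ (0,T]`. -/
def UpperSolB (u : ℝ → ℝ → ℝ) (T : ℝ) : Prop :=
  (∀ t ∈ Set.Ioc (0 : ℝ) T, ∀ x ∈ Set.Ioo (-1 : ℝ) 1,
    ut u x t ≥ uxx u x t / (1 + ux u x t ^ 2)) ∧
  (∀ t ∈ Set.Ioc (0 : ℝ) T, ux u 1 t ≥ u 1 t ∧ ux u (-1) t ≤ - u (-1) t)

/-- A lower solution of problem (B) on `[-1,1] × [0,T]` (reversed inequalities). -/
def LowerSolB (u : ℝ → ℝ → ℝ) (T : ℝ) : Prop :=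
  (∀ t ∈ Set.Ioc (0 : ℝ) T, ∀ x ∈ Set.Ioo (-1 : ℝ) 1,
    ut u x t ≤ uxx u x t / (1 + ux u x t ^ 2)) ∧
  (∀ t ∈ Set.Ioc (0 : ℝ) T, ux u 1 t ≤ u 1 t ∧ ux u (-1) t ≥ - u (-1) t)


/-! The proof doubles the space variable after the substitution `U = exp(-x²/2) u`. -/

lemma left_max_deriv {g : ℝ → ℝ} {g' a : ℝ} (h : HasDerivAt g g' a)
    (hm : ∀ᶠ s in nhdsWithin a (Set.Iio a), g s ≤ g a) : 0 ≤ g' := by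
  have h1 := (hasDerivAt_iff_tendsto_slope.1 h).mono_left
    (nhdsWithin_mono a (show Set.Iio a ⊆ {a}ᶜ from fun s hs => ne_of_lt hs))
  refine ge_of_tendsto h1 ?_
  filter_upwards [hm, self_mem_nhdsWithin] with s hs hsa
  rw [slope_def_field]
  have : s < a := hsa
  exact div_nonneg_of_nonpos (by linarith) (by linarith)

lemma right_max_deriv {g : ℝ → ℝ} {g' a : ℝ} (h : HasDerivAt g g' a)
    (hm : ∀ᶠ s in nhdsWithin a (Set.Ioi a), g s ≤ g a) : g' ≤ 0 := by
  have h1 := (hasDerivAt_iff_tendsto_slope.1 h).mono_left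
    (nhdsWithin_mono a (show Set.Ioi a ⊆ {a}ᶜ from fun s hs => ne_of_gt hs))
  refine le_of_tendsto h1 ?_
  filter_upwards [hm, self_mem_nhdsWithin] with s hs hsa
  rw [slope_def_field]
  have : a < s := hsa
  exact div_nonpos_of_nonpos_of_nonneg (by linarith) (by linarith)

lemma second_deriv_max {g g1 : ℝ → ℝ} {g2 : ℝ} (hm : IsLocalMax g 0)
    (h1 : ∀ᶠ s in nhds (0:ℝ), HasDerivAt g (g1 s) s) (h2 : HasDerivAt g1 g2 0) : g2 ≤ 0 := by
  by_contra hpos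
  push Not at hpos
  have hd : deriv g =ᶠ[nhds 0] g1 := h1.mono (fun s hs => hs.deriv)
  have hdd : deriv (deriv g) 0 = g2 := by rw [hd.deriv_eq, h2.deriv]
  have hmin : IsLocalMin g 0 :=
    isLocalMin_of_deriv_deriv_pos (by rw [hdd]; exact hpos) hm.deriv_eq_zero
      h1.self_of_nhds.continuousAt
  have hc : g =ᶠ[nhds 0] fun _ => g 0 := by
    filter_upwards [hm, hmin] with s ha hb using le_antisymm ha hb
  have hz : deriv g =ᶠ[nhds 0] fun _ => 0 := by
    have := hc.deriv
    simpa using this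
  have : deriv (deriv g) 0 = 0 := by rw [hz.deriv_eq]; simp
  linarith

noncomputable def Uf (u : ℝ → ℝ → ℝ) (x t : ℝ) : ℝ := exp (-x^2/2) * u x t
noncomputable def U1f (u : ℝ → ℝ → ℝ) (x t : ℝ) : ℝ := exp (-x^2/2) * (ux u x t - x * u x t)
noncomputable def U2f (u : ℝ → ℝ → ℝ) (x t : ℝ) : ℝ :=
  exp (-x^2/2) * (uxx u x t - 2 * x * ux u x t + (x^2 - 1) * u x t)

lemma hasDerivAt_E (x : ℝ) : HasDerivAt (fun y : ℝ => exp (-y^2/2)) (-x * exp (-x^2/2)) x := by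
  have h : HasDerivAt (fun y : ℝ => -y^2/2) (-x) x := by
    refine HasDerivAt.congr_deriv ((hasDerivAt_pow 2 x).neg.div_const 2) ?_
    norm_num
    ring
  refine HasDerivAt.congr_deriv h.exp ?_
  ring

lemma Uf_deriv {u : ℝ → ℝ → ℝ} {T x t : ℝ} (hu : C21Rect u T) (ht : t ∈ Set.Ioc 0 T)
    (hx : x ∈ Set.Icc (-1:ℝ) 1) : HasDerivAt (fun y => Uf u y t) (U1f u x t) x := by
  have h := (hu.2.2 t ht x hx).1.hasDerivAt
  refine HasDerivAt.congr_deriv ((hasDerivAt_E x).mul h) ?_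
  unfold U1f ux
  ring

lemma U1f_deriv {u : ℝ → ℝ → ℝ} {T x t : ℝ} (hu : C21Rect u T) (ht : t ∈ Set.Ioc 0 T)
    (hx : x ∈ Set.Icc (-1:ℝ) 1) : HasDerivAt (fun y => U1f u y t) (U2f u x t) x := by
  have h := (hu.2.2 t ht x hx).1.hasDerivAt
  have h' := (hu.2.2 t ht x hx).2.1.hasDerivAt
  refine HasDerivAt.congr_deriv ((hasDerivAt_E x).mul (h'.sub ((hasDerivAt_id x).mul h))) ?_
  simp only [U2f, uxx, ux, id]
  ring

lemma Uf_deriv_t {u : ℝ → ℝ → ℝ} {T x t : ℝ} (hu : C21Rect u T) (ht : t ∈ Set.Ioc 0 T)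
    (hx : x ∈ Set.Icc (-1:ℝ) 1) :
    HasDerivAt (fun s => Uf u x s) (exp (-x^2/2) * ut u x t) t :=
  (hu.2.2 t ht x hx).2.2.hasDerivAt.const_mul _

/-- The equation in the new variables. -/
lemma Uf_eq {u : ℝ → ℝ → ℝ} {T x t : ℝ} (hl : LowerSolB u T) (ht : t ∈ Set.Ioc 0 T)
    (hx : x ∈ Set.Ioo (-1:ℝ) 1) :
    exp (-x^2/2) * ut u x t ≤ (U2f u x t + 2 * x * U1f u x t + (1 + x^2) * Uf u x t)
      / (1 + (exp (x^2/2) * (U1f u x t + x * Uf u x t))^2) := by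
  have h := hl.1 t ht x hx
  have hE : exp (x^2/2) * exp (-x^2/2) = 1 := by
    rw [← exp_add]; simp; ring
  have e1 : exp (x^2/2) * (U1f u x t + x * Uf u x t) = ux u x t := by
    unfold U1f Uf
    linear_combination (ux u x t) * hE
  have e2 : U2f u x t + 2 * x * U1f u x t + (1 + x^2) * Uf u x t
      = exp (-x^2/2) * uxx u x t := by
    unfold U1f Uf U2f; ring
  rw [e1, e2, mul_div_assoc]
  exact mul_le_mul_of_nonneg_left h (exp_pos _).le

lemma sqrt_a_lip (p q : ℝ) :
    |1 / √(1 + p^2) - 1 / √(1 + q^2)| ≤ |p + q| := by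
  have hp : 0 < 1 + p^2 := by positivity
  have hq : 0 < 1 + q^2 := by positivity
  set P := √(1+p^2) with hP
  set Q := √(1+q^2) with hQ
  have hP2 : P^2 = 1 + p^2 := Real.sq_sqrt hp.le
  have hQ2 : Q^2 = 1 + q^2 := Real.sq_sqrt hq.le
  have hP1 : 1 ≤ P := by rw [hP]; exact Real.one_le_sqrt.2 (by nlinarith)
  have hQ1 : 1 ≤ Q := by rw [hQ]; exact Real.one_le_sqrt.2 (by nlinarith)
  have hPp : |p| ≤ P := abs_le_of_sq_le_sq (by nlinarith) (by linarith)
  have hQq : |q| ≤ Q := abs_le_of_sq_le_sq (by nlinarith) (by linarith)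
  have key : 1 / P - 1 / Q = (q - p) * (p + q) / ((P + Q) * (P * Q)) := by
    field_simp
    nlinarith
  have hPQ : 0 < (P + Q) * (P * Q) := by positivity
  rw [key, abs_div, abs_mul, abs_of_pos hPQ, div_le_iff₀ hPQ]
  have h1 : |q - p| ≤ P + Q := by
    have := abs_sub q p
    linarith
  have h2 : P + Q ≤ (P + Q) * (P * Q) := by
    have : 1 ≤ P * Q := by nlinarith
    nlinarith
  calc |q - p| * |p + q| ≤ ((P + Q) * (P * Q)) * |p + q| := by gcongr; linarith
    _ = _ := by ring

lemma exp_half_le {z : ℝ} (hz : z ∈ Set.Icc (-1:ℝ) 1) : exp (z^2/2) ≤ 2 := by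
  have h1 : z^2/2 ≤ 1/2 := by nlinarith [hz.1, hz.2]
  have h2 : exp (1/2 : ℝ) ≤ 2 := by
    have h3 : exp (1/2 : ℝ) * exp (1/2 : ℝ) = exp 1 := by rw [← exp_add]; norm_num
    have h4 := Real.exp_one_lt_d9
    nlinarith [exp_pos (1/2 : ℝ)]
  exact (exp_le_exp.2 h1).trans h2

lemma exp_half_lip {x y : ℝ} (hx : x ∈ Set.Icc (-1:ℝ) 1) (hy : y ∈ Set.Icc (-1:ℝ) 1) :
    |exp (x^2/2) - exp (y^2/2)| ≤ 2 * |x - y| := by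
  have := Convex.norm_image_sub_le_of_norm_hasDerivWithin_le (C := 2)
    (f := fun z : ℝ => exp (z^2/2)) (f' := fun z => exp (z^2/2) * z) (s := Set.Icc (-1:ℝ) 1)
    (x := y) (y := x) ?_ ?_ (convex_Icc _ _) hy hx
  · simpa using this
  · intro z hz
    have h : HasDerivAt (fun y : ℝ => y^2/2) z z := by
      refine HasDerivAt.congr_deriv ((hasDerivAt_pow 2 z).div_const 2) ?_
      norm_num
    exact h.exp.hasDerivWithinAt
  · intro z hz
    have h1 : |z| ≤ 1 := abs_le.2 hz
    have h2 : exp (z^2/2) ≤ 2 := exp_half_le hz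
    rw [Real.norm_eq_abs, abs_mul, abs_of_pos (exp_pos _)]
    have := exp_pos (z^2/2)
    nlinarith [abs_nonneg z]

set_option maxHeartbeats 4000000 in
lemma contact_algebra {M l μ x y U W U1 W1 U2 W2 Ut Wt K : ℝ} (hM : 1 ≤ M) (hl : 0 < l)
    (hl1 : l ≤ 1) (hμ : μ * (M + 2)^2 = l) (hx : x ∈ Set.Icc (-1:ℝ) 1)
    (hy : y ∈ Set.Icc (-1:ℝ) 1)
    (hW : |W| ≤ M) (hU1 : |U1| ≤ M) (hW1 : |W1| ≤ M) (hK : 0 ≤ K)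
    (e1 : U1 = (x - y) / μ + 2 * l * x) (e2 : W1 = -((x - y) / μ) + 2 * l * y)
    (e0 : U + W = (x - y)^2 / (2 * μ) + l * (1 + x^2 + y^2))
    (h2 : ∀ ξ η : ℝ, U2 * ξ^2 + W2 * η^2 ≤ (ξ - η)^2 / μ + 2 * l * (ξ^2 + η^2))
    (ht : K * (l * (1 + x^2 + y^2) - (x - y)^2 / (2 * μ)) ≤ Ut + Wt)
    (hUt : Ut ≤ (U2 + 2 * x * U1 + (1 + x^2) * U) / (1 + (exp (x^2/2) * (U1 + x * U))^2))
    (hWt : Wt ≤ (W2 + 2 * y * W1 + (1 + y^2) * W) / (1 + (exp (y^2/2) * (W1 + y * W))^2)) :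
    K ≤ 2 * (441 * M^2 * (M + 2)^2 + 19 + 4 * M + 168 * M^2) := by
  have hM2 : 0 < (M + 2)^2 := by positivity
  have hμ0 : 0 < μ := by
    by_contra hn
    push Not at hn
    nlinarith
  set s := (x - y) / μ with hs
  have hxy : x - y = μ * s := by rw [hs]; field_simp
  have hq : (x - y)^2 / (2 * μ) = μ * s^2 / 2 := by rw [hxy]; field_simp
  rw [hq] at e0 ht
  have hxa : |x| ≤ 1 := abs_le.2 hx
  have hya : |y| ≤ 1 := abs_le.2 hy
  have hx2 : x^2 ≤ 1 := by nlinarith [hx.1, hx.2]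
  have hy2 : y^2 ≤ 1 := by nlinarith [hy.1, hy.2]
  have hsM : |s| ≤ M + 2 := by
    have h : s = U1 - 2 * l * x := by rw [e1]; ring
    rw [abs_le] at hU1 ⊢
    have k1 : l * x ≤ 1 := by nlinarith [hx.1, hx.2]
    have k2 : -1 ≤ l * x := by nlinarith [hx.1, hx.2]
    constructor <;> rw [h] <;> linarith [hU1.1, hU1.2]
  have hs2 : μ * s^2 ≤ l := by
    have : s^2 ≤ (M+2)^2 := sq_le_sq' (abs_le.1 hsM).1 (abs_le.1 hsM).2
    rw [← hμ]; gcongr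
  have hd : |x - y| ≤ l := by
    rw [hxy, abs_mul, abs_of_pos hμ0, ← hμ]
    have : |s| ≤ (M+2)^2 := by nlinarith
    gcongr
  -- time derivative
  have hT : K * l / 2 ≤ Ut + Wt := by
    refine le_trans ?_ ht
    have : l / 2 ≤ l * (1 + x^2 + y^2) - μ * s^2 / 2 := by
      have := mul_nonneg hl.le (add_nonneg (sq_nonneg x) (sq_nonneg y))
      linarith
    have := mul_le_mul_of_nonneg_left this hK
    linarith
  -- bounds of differences
  have b0 : |U + W| ≤ 7/2 * l := by
    rw [e0, abs_of_nonneg (by positivity)]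
    have k1 : l * (1 + x^2 + y^2) ≤ l * 3 := mul_le_mul_of_nonneg_left (by linarith) hl.le
    linarith
  have b1 : |U1 + W1| ≤ 4 * l := by
    have : U1 + W1 = 2 * l * (x + y) := by rw [e1, e2]; ring
    rw [this, abs_le]
    have k1 : 0 ≤ l * (2 - (x + y)) := mul_nonneg hl.le (by linarith [hx.2, hy.2])
    have k2 : 0 ≤ l * (2 + (x + y)) := mul_nonneg hl.le (by linarith [hx.1, hy.1])
    constructor <;> linarith
  have b2 : |x * U + y * W| ≤ 7/2 * l + M * l := by
    have : x * U + y * W = x * (U + W) - (x - y) * W := by ring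
    rw [this]
    refine (abs_sub _ _).trans ?_
    rw [abs_mul, abs_mul]
    have i1 : |x| * |U + W| ≤ 1 * (7/2 * l) := by gcongr
    have i2 : |x - y| * |W| ≤ l * M := by gcongr
    linarith
  have b3 : |W1 + y * W| ≤ 2 * M := by
    refine (abs_add_le _ _).trans ?_
    rw [abs_mul]
    have : |y| * |W| ≤ 1 * M := by gcongr
    linarith
  set p := exp (x^2/2) * (U1 + x * U) with hp
  set q := exp (y^2/2) * (W1 + y * W) with hq'
  have bpq : |p + q| ≤ 21 * M * l := by
    have : p + q = exp (x^2/2) * ((U1 + W1) + (x * U + y * W))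
        - (exp (x^2/2) - exp (y^2/2)) * (W1 + y * W) := by rw [hp, hq']; ring
    rw [this]
    refine (abs_sub _ _).trans ?_
    rw [abs_mul, abs_mul, abs_of_pos (exp_pos _)]
    have i1 : exp (x^2/2) * |(U1 + W1) + (x * U + y * W)| ≤ 2 * (4 * l + (7/2 * l + M * l)) := by
      have := exp_half_le hx
      have i := (abs_add_le (U1 + W1) (x * U + y * W)).trans (add_le_add b1 b2)
      gcongr
    have i2 : |exp (x^2/2) - exp (y^2/2)| * |W1 + y * W| ≤ (2 * l) * (2 * M) := by
      have := (exp_half_lip hx hy).trans (mul_le_mul_of_nonneg_left hd (by norm_num))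
      gcongr
    have i3 : l ≤ M * l := le_mul_of_one_le_left hl.le hM
    linarith
  set ξ := 1 / √(1 + p^2) with hξ
  set η := 1 / √(1 + q^2) with hη
  have hlip : |ξ - η| ≤ 21 * M * l := (sqrt_a_lip p q).trans bpq
  have hξ2 : 1 / (1 + p^2) = ξ^2 := by
    rw [hξ, div_pow, Real.sq_sqrt (by positivity), one_pow]
  have hη2 : 1 / (1 + q^2) = η^2 := by
    rw [hη, div_pow, Real.sq_sqrt (by positivity), one_pow]
  have hξ0 : 0 ≤ ξ := by positivity
  have hη0 : 0 ≤ η := by positivity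
  have hξ1 : ξ^2 ≤ 1 := by
    rw [← hξ2, div_le_one (by positivity)]; linarith [sq_nonneg p]
  have hη1 : η^2 ≤ 1 := by
    rw [← hη2, div_le_one (by positivity)]; linarith [sq_nonneg q]
  have hξ1' : ξ ≤ 1 := (sq_le_one_iff₀ hξ0).1 hξ1
  have hη1' : η ≤ 1 := (sq_le_one_iff₀ hη0).1 hη1
  rw [div_eq_mul_one_div, hξ2] at hUt
  rw [div_eq_mul_one_div, hη2] at hWt
  have H2 := h2 ξ η
  have j1 : (ξ - η)^2 / μ ≤ 441 * M^2 * (M+2)^2 * l := by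
    rw [div_le_iff₀ hμ0]
    have : (ξ - η)^2 ≤ (21 * M * l)^2 := sq_le_sq' (abs_le.1 hlip).1 (abs_le.1 hlip).2
    have e : 441 * M^2 * (M+2)^2 * l * μ = (21 * M * l)^2 := by rw [← hμ]; ring
    rw [e]; exact this
  have j2 : 2 * l * (ξ^2 + η^2) ≤ 4 * l := by
    have := mul_le_mul_of_nonneg_left (add_le_add hξ1 hη1) hl.le
    linarith
  -- lower order terms
  have R2 : |2 * y * W1 + (1 + y^2) * W| ≤ 4 * M := by
    refine (abs_add_le _ _).trans ?_
    rw [abs_mul, abs_mul, abs_mul, abs_of_pos (show (0:ℝ) < 2 by norm_num),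
      abs_of_pos (show (0:ℝ) < 1 + y^2 by positivity)]
    have i1 : 2 * |y| * |W1| ≤ 2 * 1 * M := by gcongr
    have i2 : (1 + y^2) * |W| ≤ (1 + 1) * M := by gcongr
    linarith
  have R12 : |(2 * x * U1 + (1 + x^2) * U) + (2 * y * W1 + (1 + y^2) * W)| ≤ (15 + 4 * M) * l := by
    have : (2 * x * U1 + (1 + x^2) * U) + (2 * y * W1 + (1 + y^2) * W)
      = (2 * x * (U1 + W1) + (1 + x^2) * (U + W)) - (x - y) * (2 * W1 + (x + y) * W) := by ring
    rw [this]
    refine (abs_sub _ _).trans ?_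
    have i0 := abs_add_le (2 * x * (U1 + W1)) ((1 + x^2) * (U + W))
    have i1 : |2 * x * (U1 + W1)| ≤ 2 * 1 * (4 * l) := by
      rw [abs_mul, abs_mul, abs_of_pos (show (0:ℝ) < 2 by norm_num)]; gcongr
    have i2 : |(1 + x^2) * (U + W)| ≤ (1 + 1) * (7/2 * l) := by
      rw [abs_mul, abs_of_pos (show (0:ℝ) < 1 + x^2 by positivity)]; gcongr
    have i3 : |(x - y) * (2 * W1 + (x + y) * W)| ≤ l * (4 * M) := by
      rw [abs_mul]
      have k1 : |2 * W1 + (x + y) * W| ≤ 4 * M := by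
        refine (abs_add_le _ _).trans ?_
        rw [abs_mul, abs_mul, abs_of_pos (show (0:ℝ) < 2 by norm_num)]
        have k2 : |x + y| ≤ 2 := (abs_add_le _ _).trans (by linarith)
        have k3 : |x + y| * |W| ≤ 2 * M := by gcongr
        linarith
      gcongr
    linarith
  set r1 := 2 * x * U1 + (1 + x^2) * U with hr1
  set r2 := 2 * y * W1 + (1 + y^2) * W with hr2
  have j3 : ξ^2 * r1 + η^2 * r2 ≤ (15 + 4 * M) * l + 168 * M^2 * l := by
    have e : ξ^2 * r1 + η^2 * r2 = ξ^2 * (r1 + r2) - (ξ - η) * (ξ + η) * r2 := by ring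
    rw [e]
    have i1 : ξ^2 * (r1 + r2) ≤ 1 * ((15 + 4 * M) * l) := by
      have k0 := le_abs_self (ξ^2 * (r1 + r2))
      rw [abs_mul, abs_of_nonneg (sq_nonneg ξ)] at k0
      refine k0.trans ?_
      gcongr
    have i2 : -((ξ - η) * (ξ + η) * r2) ≤ (21 * M * l) * 2 * (4 * M) := by
      refine (neg_le_abs _).trans ?_
      rw [abs_mul, abs_mul]
      have : |ξ + η| ≤ 2 := by rw [abs_of_nonneg (by linarith)]; linarith
      gcongr
    linarith
  have fin : K * l / 2 ≤ (441 * M^2 * (M + 2)^2 + 19 + 4 * M + 168 * M^2) * l := by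
    have k1 : Ut ≤ U2 * ξ^2 + ξ^2 * r1 := by rw [hr1]; linarith
    have k2 : Wt ≤ W2 * η^2 + η^2 * r2 := by rw [hr2]; linarith
    linarith
  have : K * l ≤ (2 * (441 * M^2 * (M + 2)^2 + 19 + 4 * M + 168 * M^2)) * l := by linarith
  exact le_of_mul_le_mul_right this hl

lemma contact_first {u : ℝ → ℝ → ℝ} {T t x y l μ : ℝ} (hu : C21Rect u T) (lu : LowerSolB u T)
    (ht : t ∈ Set.Ioc 0 T) (hx : x ∈ Set.Icc (-1:ℝ) 1) (hy : y ∈ Set.Icc (-1:ℝ) 1)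
    (hl : 0 < l) (hμ : 0 < μ)
    (hm : ∀ z ∈ Set.Icc (-1:ℝ) 1, Uf u z t - ((z - y)^2 / (2 * μ) + l * z^2)
      ≤ Uf u x t - ((x - y)^2 / (2 * μ) + l * x^2)) :
    x ∈ Set.Ioo (-1:ℝ) 1 ∧ U1f u x t = (x - y) / μ + 2 * l * x := by
  have hd : HasDerivAt (fun z => Uf u z t - ((z - y)^2 / (2 * μ) + l * z^2))
      (U1f u x t - ((x - y) / μ + 2 * l * x)) x := by
    refine HasDerivAt.congr_deriv ((Uf_deriv hu ht hx).sub
      (((((hasDerivAt_id x).sub_const y).pow 2).div_const (2 * μ)).add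
        ((hasDerivAt_pow 2 x).const_mul l))) ?_
    simp only [id]
    field_simp
    norm_num
    try ring
  have hlt : x < 1 := by
    by_contra hn
    have h1 : x = 1 := le_antisymm hx.2 (not_lt.1 hn)
    subst h1
    have h0 := left_max_deriv hd (by
      filter_upwards [Ioo_mem_nhdsLT (show (-1:ℝ) < 1 by norm_num)] with z hz
      exact hm z ⟨hz.1.le, hz.2.le⟩)
    have hb : U1f u 1 t ≤ 0 := by
      have := (lu.2 t ht).1
      exact mul_nonpos_of_nonneg_of_nonpos (exp_pos _).le (by linarith)
    have : 0 ≤ (1 - y) / μ := div_nonneg (by linarith [hy.2]) hμ.le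
    linarith
  have hgt : -1 < x := by
    by_contra hn
    have h1 : x = -1 := le_antisymm (not_lt.1 hn) hx.1
    subst h1
    have h0 := right_max_deriv hd (by
      filter_upwards [Ioo_mem_nhdsGT (show (-1:ℝ) < 1 by norm_num)] with z hz
      exact hm z ⟨hz.1.le, hz.2.le⟩)
    have hb : 0 ≤ U1f u (-1) t := by
      have := (lu.2 t ht).2
      exact mul_nonneg (exp_pos _).le (by linarith)
    have : (-1 - y) / μ ≤ 0 := div_nonpos_of_nonpos_of_nonneg (by linarith [hy.1]) hμ.le
    linarith
  refine ⟨⟨hgt, hlt⟩, ?_⟩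
  have hloc : IsLocalMax (fun z => Uf u z t - ((z - y)^2 / (2 * μ) + l * z^2)) x := by
    filter_upwards [Icc_mem_nhds hgt hlt] with z hz using hm z hz
  have := hloc.hasDerivAt_eq_zero hd
  linarith

lemma contact_second {u v : ℝ → ℝ → ℝ} {T t x y l μ : ℝ} (hu : C21Rect u T) (hv : C21Rect v T)
    (ht : t ∈ Set.Ioc 0 T) (hx : x ∈ Set.Ioo (-1:ℝ) 1) (hy : y ∈ Set.Ioo (-1:ℝ) 1)
    (hμ : 0 < μ)
    (hm : ∀ z ∈ Set.Icc (-1:ℝ) 1, ∀ w ∈ Set.Icc (-1:ℝ) 1,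
      Uf u z t + Uf v w t - ((z - w)^2 / (2 * μ) + l * (1 + z^2 + w^2))
      ≤ Uf u x t + Uf v y t - ((x - y)^2 / (2 * μ) + l * (1 + x^2 + y^2))) (ξ η : ℝ) :
    U2f u x t * ξ^2 + U2f v y t * η^2 ≤ (ξ - η)^2 / μ + 2 * l * (ξ^2 + η^2) := by
  have line : ∀ a b s : ℝ, HasDerivAt (fun s : ℝ => a + s * b) b s := fun a b s => by
    simpa using ((hasDerivAt_id s).mul_const b).const_add a
  have nx : ∀ᶠ s in nhds (0:ℝ), x + s * ξ ∈ Set.Icc (-1:ℝ) 1 :=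
    (line x ξ 0).continuousAt.eventually 
      (by beta_reduce; rw [zero_mul, add_zero]; exact Icc_mem_nhds hx.1 hx.2)
  have ny : ∀ᶠ s in nhds (0:ℝ), y + s * η ∈ Set.Icc (-1:ℝ) 1 :=
    (line y η 0).continuousAt.eventually 
      (by beta_reduce; rw [zero_mul, add_zero]; exact Icc_mem_nhds hy.1 hy.2)
  have key := second_deriv_max
    (g := fun s => Uf u (x + s * ξ) t + Uf v (y + s * η) t
      - (((x + s * ξ) - (y + s * η))^2 / (2 * μ) + l * (1 + (x + s * ξ)^2 + (y + s * η)^2)))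
    (g1 := fun s => U1f u (x + s * ξ) t * ξ + U1f v (y + s * η) t * η
      - (((x + s * ξ) - (y + s * η)) * (ξ - η) / μ
        + 2 * l * ((x + s * ξ) * ξ + (y + s * η) * η)))
    (g2 := U2f u x t * ξ * ξ + U2f v y t * η * η
      - ((ξ - η) * (ξ - η) / μ + 2 * l * (ξ * ξ + η * η))) ?_ ?_ ?_
  · have : (ξ - η)^2 / μ = (ξ - η) * (ξ - η) / μ := by ring
    rw [this]
    nlinarith
  · filter_upwards [nx, ny] with s h1 h2
    simpa using hm _ h1 _ h2
  · filter_upwards [nx, ny] with s h1 h2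
    have d1 := HasDerivAt.comp s (Uf_deriv hu ht h1) (line x ξ s)
    have d2 := HasDerivAt.comp s (Uf_deriv hv ht h2) (line y η s)
    have d3 := (((line x ξ s).sub (line y η s)).pow 2).div_const (2 * μ)
    have d4 := ((((line x ξ s).pow 2).const_add 1).add ((line y η s).pow 2)).const_mul l
    refine HasDerivAt.congr_deriv ((d1.add d2).sub (d3.add d4)) ?_
    simp only [Pi.sub_apply]
    field_simp
    norm_num
    try ring
  · have h1 : x + 0 * ξ ∈ Set.Icc (-1:ℝ) 1 := by simpa using ⟨hx.1.le, hx.2.le⟩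
    have h2 : y + 0 * η ∈ Set.Icc (-1:ℝ) 1 := by simpa using ⟨hy.1.le, hy.2.le⟩
    have d1 := (HasDerivAt.comp 0 (U1f_deriv hu ht h1) (line x ξ 0)).mul_const ξ
    have d2 := (HasDerivAt.comp 0 (U1f_deriv hv ht h2) (line y η 0)).mul_const η
    have d3 := (((line x ξ 0).sub (line y η 0)).mul_const (ξ - η)).div_const μ
    have d4 := (((line x ξ 0).mul_const ξ).add ((line y η 0).mul_const η)).const_mul (2 * l)
    refine HasDerivAt.congr_deriv ((d1.add d2).sub (d3.add d4)) ?_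
    simp

noncomputable def psiB (M δ K x y t : ℝ) : ℝ :=
  (x - y)^2 * ((M + 2)^2 / (2 * δ)) * exp (-K * t) + δ * (1 + x^2 + y^2) * exp (K * t)

lemma contact {u v : ℝ → ℝ → ℝ} {T M K δ x y t : ℝ} (hu : C21Rect u T) (hv : C21Rect v T)
    (lu : LowerSolB u T) (lv : LowerSolB v T) (hM : 1 ≤ M) (hδ : 0 < δ) (hK : 0 ≤ K)
    (ht : t ∈ Set.Ioc 0 T) (hx : x ∈ Set.Icc (-1:ℝ) 1) (hy : y ∈ Set.Icc (-1:ℝ) 1)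
    (hδ1 : δ * exp (K * t) ≤ 1)
    (hW : |Uf v y t| ≤ M) (hU1 : |U1f u x t| ≤ M) (hW1 : |U1f v y t| ≤ M)
    (h0 : Uf u x t + Uf v y t - psiB M δ K x y t = 0)
    (hle : ∀ s ∈ Set.Ioc 0 t, ∀ z ∈ Set.Icc (-1:ℝ) 1, ∀ w ∈ Set.Icc (-1:ℝ) 1,
      Uf u z s + Uf v w s - psiB M δ K z w s ≤ 0) :
    K ≤ 2 * (441 * M^2 * (M + 2)^2 + 19 + 4 * M + 168 * M^2) := by
  set l := δ * exp (K * t) with hl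
  have hl0 : 0 < l := by positivity
  set μ := l / (M + 2)^2 with hμ
  have hμ0 : 0 < μ := by positivity
  have hexp : exp (-K * t) = 1 / exp (K * t) := by
    rw [neg_mul, exp_neg, one_div]
  have hpsi : ∀ z w : ℝ, psiB M δ K z w t = (z - w)^2 / (2 * μ) + l * (1 + z^2 + w^2) := by
    intro z w
    unfold psiB
    rw [hexp, hμ, hl]
    have := exp_pos (K * t)
    field_simp
  have hm : ∀ z ∈ Set.Icc (-1:ℝ) 1, ∀ w ∈ Set.Icc (-1:ℝ) 1,
      Uf u z t + Uf v w t - ((z - w)^2 / (2 * μ) + l * (1 + z^2 + w^2))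
      ≤ Uf u x t + Uf v y t - ((x - y)^2 / (2 * μ) + l * (1 + x^2 + y^2)) := by
    intro z hz w hw
    rw [← hpsi, ← hpsi, h0]
    exact hle t ⟨ht.1, le_rfl⟩ z hz w hw
  obtain ⟨hxo, e1⟩ := contact_first hu lu ht hx hy hl0 hμ0 (fun z hz => by
    have := hm z hz y hy
    linarith)
  obtain ⟨hyo, e2⟩ := contact_first hv lv ht hy hx hl0 hμ0 (fun w hw => by
    have := hm x hx w hw
    have k1 : (w - x)^2 = (x - w)^2 := by ring
    have k2 : (y - x)^2 = (x - y)^2 := by ring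
    rw [k1, k2]
    linarith)
  have htime : K * (l * (1 + x^2 + y^2) - (x - y)^2 / (2 * μ))
      ≤ exp (-x^2/2) * ut u x t + exp (-y^2/2) * ut v y t := by
    have lin : ∀ k : ℝ, HasDerivAt (fun s : ℝ => exp (k * s)) (exp (k * t) * k) t := fun k => by
      have : HasDerivAt (fun s : ℝ => k * s) k t := by
        simpa using (hasDerivAt_id t).const_mul k
      exact this.exp
    have dpsi : HasDerivAt (fun s => psiB M δ K x y s)
        (K * (l * (1 + x^2 + y^2) - (x - y)^2 / (2 * μ))) t := by
      refine HasDerivAt.congr_deriv (((lin (-K)).const_mul ((x - y)^2 * ((M + 2)^2 / (2 * δ)))).add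
        ((lin K).const_mul (δ * (1 + x^2 + y^2)))) ?_
      rw [hexp, hμ, hl]
      have := exp_pos (K * t)
      field_simp
      ring
    have := left_max_deriv (((Uf_deriv_t hu ht hx).add (Uf_deriv_t hv ht hy)).sub dpsi) (by
      filter_upwards [Ioo_mem_nhdsLT ht.1] with s hs
      have h1 := hle s ⟨hs.1, hs.2.le⟩ x hx y hy
      simp only [Pi.sub_apply, Pi.add_apply]
      linarith)
    linarith
  refine contact_algebra hM hl0 hδ1 (by rw [hμ]; field_simp) hx hy hW hU1 hW1 hK e1 ?_ ?_
    (contact_second hu hv ht hxo hyo hμ0 hm) htime (Uf_eq lu ht hxo) (Uf_eq lv ht hyo)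
  · rw [e2]; ring
  · rw [← hpsi]; linarith

lemma C21Rect.negate {u : ℝ → ℝ → ℝ} {T : ℝ} (hu : C21Rect u T) :
    C21Rect (fun x t => -u x t) T := by
  have e : ∀ x t, ux (fun x t => -u x t) x t = -ux u x t := fun x t => by
    unfold ux; exact deriv.fun_neg
  refine ⟨hu.1.neg, ?_, ?_⟩
  · simp only [e]; exact hu.2.1.neg
  · intro t ht x hx
    obtain ⟨h1, h2, h3⟩ := hu.2.2 t ht x hx
    refine ⟨h1.neg, ?_, h3.neg⟩
    simp only [e]; exact h2.neg

lemma UpperSolB.negate {u : ℝ → ℝ → ℝ} {T : ℝ} (hu : UpperSolB u T) :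
    LowerSolB (fun x t => -u x t) T := by
  have e : ∀ x t, ux (fun x t => -u x t) x t = -ux u x t := fun x t => by
    unfold ux; exact deriv.fun_neg
  have e2 : ∀ x t, uxx (fun x t => -u x t) x t = -uxx u x t := fun x t => by
    unfold uxx; simp only [e]; exact deriv.fun_neg
  have e3 : ∀ x t, ut (fun x t => -u x t) x t = -ut u x t := fun x t => by
    unfold ut; exact deriv.fun_neg
  refine ⟨?_, ?_⟩
  · intro t ht x hx
    have := hu.1 t ht x hx
    rw [e, e2, e3, neg_sq, neg_div]
    linarith
  · intro t ht
    have := hu.2 t ht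
    rw [e, e]
    constructor <;> linarith [this.1, this.2]

lemma Uf_cont {u : ℝ → ℝ → ℝ} {T : ℝ} (hu : C21Rect u T) :
    ContinuousOn (fun p : ℝ × ℝ => Uf u p.1 p.2)
      (Set.Icc (-1 : ℝ) 1 ×ˢ Set.Icc (0 : ℝ) T) := by
  have : Continuous (fun p : ℝ × ℝ => exp (-p.1^2/2)) := by fun_prop
  exact this.continuousOn.mul hu.1

lemma U1f_cont {u : ℝ → ℝ → ℝ} {T : ℝ} (hu : C21Rect u T) :
    ContinuousOn (fun p : ℝ × ℝ => U1f u p.1 p.2)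
      (Set.Icc (-1 : ℝ) 1 ×ˢ Set.Icc (0 : ℝ) T) := by
  have : Continuous (fun p : ℝ × ℝ => exp (-p.1^2/2)) := by fun_prop
  exact this.continuousOn.mul (hu.2.1.sub (continuous_fst.continuousOn.mul hu.1))

lemma Uf_bounds {u : ℝ → ℝ → ℝ} {T : ℝ} (hu : C21Rect u T) :
    ∃ M, ∀ x ∈ Set.Icc (-1:ℝ) 1, ∀ t ∈ Set.Icc (0:ℝ) T, |Uf u x t| ≤ M ∧ |U1f u x t| ≤ M := by
  have hc : IsCompact (Set.Icc (-1 : ℝ) 1 ×ˢ Set.Icc (0 : ℝ) T) := isCompact_Icc.prod isCompact_Icc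
  obtain ⟨A, hA⟩ := hc.exists_bound_of_continuousOn (Uf_cont hu)
  obtain ⟨B, hB⟩ := hc.exists_bound_of_continuousOn (U1f_cont hu)
  refine ⟨max A B, fun x hx t ht => ⟨?_, ?_⟩⟩
  · exact (hA (x, t) ⟨hx, ht⟩).trans (le_max_left _ _)
  · exact (hB (x, t) ⟨hx, ht⟩).trans (le_max_right _ _)

lemma Uf_cont_t {u : ℝ → ℝ → ℝ} {T x : ℝ} (hu : C21Rect u T) (hx : x ∈ Set.Icc (-1:ℝ) 1) :
    ContinuousOn (fun t => Uf u x t) (Set.Icc (0 : ℝ) T) :=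
  (Uf_cont hu).comp (f := fun t : ℝ => (x, t)) (by fun_prop) (fun t ht => ⟨hx, ht⟩)

lemma Uf_lip {u : ℝ → ℝ → ℝ} {T M : ℝ} (hT : 0 < T) (hu : C21Rect u T)
    (hM : ∀ x ∈ Set.Icc (-1:ℝ) 1, ∀ t ∈ Set.Icc (0:ℝ) T, |U1f u x t| ≤ M)
    {x y : ℝ} (hx : x ∈ Set.Icc (-1:ℝ) 1) (hy : y ∈ Set.Icc (-1:ℝ) 1) :
    Uf u x 0 - Uf u y 0 ≤ M * |x - y| := by
  have hpos : ∀ t ∈ Set.Ioc 0 T, Uf u x t - Uf u y t ≤ M * |x - y| := by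
    intro t ht
    have := Convex.norm_image_sub_le_of_norm_hasDerivWithin_le (C := M)
      (f := fun z : ℝ => Uf u z t) (f' := fun z => U1f u z t) (s := Set.Icc (-1:ℝ) 1)
      (x := y) (y := x) (fun z hz => (Uf_deriv hu ht hz).hasDerivWithinAt)
      (fun z hz => hM z hz t ⟨ht.1.le, ht.2⟩) (convex_Icc _ _) hy hx
    exact (le_abs_self _).trans this
  have hc : ContinuousWithinAt (fun t => Uf u x t - Uf u y t) (Set.Ioc 0 T) 0 :=
    (((Uf_cont_t hu hx).sub (Uf_cont_t hu hy)) 0 ⟨le_rfl, hT.le⟩).mono Set.Ioc_subset_Icc_self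
  have hne : (nhdsWithin (0:ℝ) (Set.Ioc 0 T)).NeBot := by
    rw [← mem_closure_iff_nhdsWithin_neBot, closure_Ioc hT.ne]
    exact ⟨le_rfl, hT.le⟩
  refine le_of_tendsto hc ?_
  filter_upwards [self_mem_nhdsWithin] with t ht using hpos t ht
/-- the comparison principle. If `ū` is an upper solution and
`u_` a lower solution of (B), both `C^{2,1}` on `[-1,1] × [0,T]`, ordered at
`t = 0`, then they stay ordered for all `t ∈ [0,T]`. -/
theorem stmt_2 (T : ℝ) (hT : 0 < T) (ubar ulow : ℝ → ℝ → ℝ)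
    (hubar : C21Rect ubar T) (hulow : C21Rect ulow T)
    (hupper : UpperSolB ubar T) (hlower : LowerSolB ulow T)
    (hinit : ∀ x ∈ Set.Icc (-1 : ℝ) 1, ulow x 0 ≤ ubar x 0) :
    ∀ x ∈ Set.Icc (-1 : ℝ) 1, ∀ t ∈ Set.Icc (0 : ℝ) T, ulow x t ≤ ubar x t := by

  set v : ℝ → ℝ → ℝ := fun x t => -ubar x t with hvdef
  have hv : C21Rect v T := hubar.negate
  have lv : LowerSolB v T := hupper.negate
  obtain ⟨A, hA⟩ := Uf_bounds hulow
  obtain ⟨B, hB⟩ := Uf_bounds hv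
  set M := max 1 (max A B) with hMdef
  have hM1 : 1 ≤ M := le_max_left _ _
  have hAM : A ≤ M := (le_max_left _ _).trans (le_max_right _ _)
  have hBM : B ≤ M := (le_max_right _ _).trans (le_max_right _ _)
  set C := 2 * (441 * M^2 * (M + 2)^2 + 19 + 4 * M + 168 * M^2) with hC
  have hC0 : 0 ≤ C := by positivity
  set K := C + 1 with hK
  intro x1 hx1 t1 ht1
  by_contra hcon
  push Not at hcon
  have hpos : 0 < Uf ulow x1 t1 + Uf v x1 t1 := by
    have : Uf ulow x1 t1 + Uf v x1 t1 = exp (-x1^2/2) * (ulow x1 t1 - ubar x1 t1) := by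
      simp only [Uf, hvdef]; ring
    rw [this]
    exact mul_pos (exp_pos _) (by linarith)
  set m := Uf ulow x1 t1 + Uf v x1 t1 with hm
  set δ := min (1 / exp (K * T)) (m / (3 * exp (K * T))) with hδ
  have heT := exp_pos (K * T)
  have hδ0 : 0 < δ := lt_min (by positivity) (by positivity)
  have hexpm : ∀ t ≤ T, exp (K * t) ≤ exp (K * T) := fun t ht => by
    apply exp_le_exp.2
    have : 0 ≤ K := by linarith
    gcongr
  have hδ1 : ∀ t ≤ T, δ * exp (K * t) ≤ 1 := fun t ht => by
    have h1 : δ ≤ 1 / exp (K * T) := min_le_left _ _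
    rw [le_div_iff₀ heT] at h1
    have := hexpm t ht
    nlinarith
  have hδm : δ * exp (K * t1) * 3 ≤ m := by
    have h1 : δ ≤ m / (3 * exp (K * T)) := min_le_right _ _
    rw [le_div_iff₀ (by positivity)] at h1
    have := hexpm t1 ht1.2
    nlinarith
  -- the doubled function
  set Φ : ℝ × ℝ × ℝ → ℝ := fun p => Uf ulow p.1 p.2.2 + Uf v p.2.1 p.2.2
    - psiB M δ K p.1 p.2.1 p.2.2 with hΦ
  set R : Set (ℝ × ℝ × ℝ) := Set.Icc (-1:ℝ) 1 ×ˢ Set.Icc (-1:ℝ) 1 ×ˢ Set.Icc (0:ℝ) T with hR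
  have hRc : IsCompact R := isCompact_Icc.prod (isCompact_Icc.prod isCompact_Icc)
  have hΦc : ContinuousOn Φ R := by
    have c1 : ContinuousOn (fun p : ℝ × ℝ × ℝ => Uf ulow p.1 p.2.2) R :=
      (Uf_cont hulow).comp (f := fun p : ℝ × ℝ × ℝ => (p.1, p.2.2)) (by fun_prop)
        (fun p hp => ⟨hp.1, hp.2.2⟩)
    have c2 : ContinuousOn (fun p : ℝ × ℝ × ℝ => Uf v p.2.1 p.2.2) R :=
      (Uf_cont hv).comp (f := fun p : ℝ × ℝ × ℝ => (p.2.1, p.2.2)) (by fun_prop)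
        (fun p hp => ⟨hp.2.1, hp.2.2⟩)
    have c3 : Continuous (fun p : ℝ × ℝ × ℝ => psiB M δ K p.1 p.2.1 p.2.2) := by
      unfold psiB; fun_prop
    exact (c1.add c2).sub c3.continuousOn
  have hSc : IsCompact (R ∩ Φ ⁻¹' Set.Ici 0) :=
    hRc.of_isClosed_subset (hΦc.preimage_isClosed_of_isClosed hRc.isClosed isClosed_Ici)
      Set.inter_subset_left
  have hSne : (R ∩ Φ ⁻¹' Set.Ici 0).Nonempty := by
    refine ⟨(x1, x1, t1), ⟨hx1, hx1, ht1⟩, ?_⟩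
    simp only [Set.mem_preimage, Set.mem_Ici, hΦ, ← hm, psiB]
    have h1 : x1^2 ≤ 1 := by nlinarith [hx1.1, hx1.2]
    have h2 : 0 ≤ δ * exp (K * t1) * (2 - 2 * x1^2) := by
      apply mul_nonneg (by positivity); linarith
    nlinarith
  obtain ⟨⟨x0, y0, t0⟩, ⟨⟨hx0, hy0, ht0⟩, hΦ0⟩, hmin⟩ :=
    hSc.exists_isMinOn hSne (f := fun p : ℝ × ℝ × ℝ => p.2.2) (by fun_prop)
  simp only at hx0 hy0 ht0
  have hΦ0' : 0 ≤ Φ (x0, y0, t0) := hΦ0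
  have hbefore : ∀ s ∈ Set.Ico 0 t0, ∀ z ∈ Set.Icc (-1:ℝ) 1, ∀ w ∈ Set.Icc (-1:ℝ) 1,
      Φ (z, w, s) < 0 := by
    intro s hs z hz w hw
    by_contra hn
    have := hmin (show (z, w, s) ∈ R ∩ Φ ⁻¹' Set.Ici 0 from
      ⟨⟨hz, hw, hs.1, hs.2.le.trans ht0.2⟩, not_lt.1 hn⟩)
    exact absurd hs.2 (not_lt.2 this)
  have ht0pos : 0 < t0 := by
    rcases ht0.1.lt_or_eq with h | h
    · exact h
    exfalso
    rw [← h] at hΦ0'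
    have h1 := Uf_lip hT hulow (fun x hx t ht => ((hA x hx t ht).2.trans hAM)) hx0 hy0
    have h2 : Uf ulow y0 0 + Uf v y0 0 ≤ 0 := by
      have : Uf ulow y0 0 + Uf v y0 0 = exp (-y0^2/2) * (ulow y0 0 - ubar y0 0) := by
        simp only [Uf, hvdef]; ring
      rw [this]
      exact mul_nonpos_of_nonneg_of_nonpos (exp_pos _).le (by linarith [hinit y0 hy0])
    have h3 : M * |x0 - y0| < psiB M δ K x0 y0 0 := by
      simp only [psiB, mul_zero, exp_zero, mul_one]
      set d := |x0 - y0| with hd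
      have hd0 : 0 ≤ d := abs_nonneg _
      have hd2 : (x0 - y0)^2 = d^2 := (sq_abs _).symm
      rw [hd2]
      have k1 : M * d ≤ d^2 * (M^2 / (2 * δ)) + δ / 2 := by
        have : d^2 * (M^2 / (2 * δ)) + δ / 2 - M * d = (M * d - δ)^2 / (2 * δ) := by
          field_simp; ring
        have : 0 ≤ (M * d - δ)^2 / (2 * δ) := by positivity
        linarith
      have k2 : d^2 * (M^2 / (2 * δ)) ≤ d^2 * ((M + 2)^2 / (2 * δ)) := by
        gcongr; linarith
      have k3 : 0 ≤ δ * (x0^2 + y0^2) := by positivity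
      nlinarith
    simp only [hΦ] at hΦ0'
    linarith
  have hle0 : ∀ z ∈ Set.Icc (-1:ℝ) 1, ∀ w ∈ Set.Icc (-1:ℝ) 1, Φ (z, w, t0) ≤ 0 := by
    intro z hz w hw
    have hc : ContinuousOn (fun s : ℝ => Φ (z, w, s)) (Set.Icc 0 T) :=
      hΦc.comp (f := fun s : ℝ => (z, w, s)) (by fun_prop) (fun s hs => ⟨hz, hw, hs⟩)
    have hc' : ContinuousWithinAt (fun s : ℝ => Φ (z, w, s)) (Set.Ico 0 t0) t0 :=
      (hc t0 ht0).mono (fun s hs => ⟨hs.1, hs.2.le.trans ht0.2⟩)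
    have hne : (nhdsWithin t0 (Set.Ico 0 t0)).NeBot := by
      rw [← mem_closure_iff_nhdsWithin_neBot, closure_Ico ht0pos.ne]
      exact ⟨ht0pos.le, le_rfl⟩
    refine le_of_tendsto hc' ?_
    filter_upwards [self_mem_nhdsWithin] with s hs using (hbefore s hs z hz w hw).le
  have hfin : K ≤ C := contact hulow hv hlower lv hM1 hδ0 (by linarith) ⟨ht0pos, ht0.2⟩ hx0 hy0
    (hδ1 t0 ht0.2) ((hB y0 hy0 t0 ht0).1.trans hBM) ((hA x0 hx0 t0 ht0).2.trans hAM)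
    ((hB y0 hy0 t0 ht0).2.trans hBM) (le_antisymm (hle0 x0 hx0 y0 hy0) hΦ0')
    (fun s hs z hz w hw => by
      rcases hs.2.lt_or_eq with h | h
      · exact (hbefore s ⟨hs.1.le, h⟩ z hz w hw).le
      · rw [h]; exact hle0 z hz w hw)
  linarith
end

section
/- Two classical solutions of problem (B) on [-1,1]×[0,T] with the same initial data u0 ∈ C^1([-1,1]) coincide on [-1,1]×[0,T]. -/
open Real

/-- A classical solution of problem (B) on `[-1,1] × [0,T]` with initial data `u0`:
`u` and `u_x` are continuous on the closed rectangle, `u` is `C^{2,1}` in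
`(-1,1) × (0,T]` where it satisfies `u_t = u_xx/(1+u_x²)`, with boundary
conditions `u_x(±1,t) = ±u(±1,t)` and initial condition `u(·,0) = u0`. -/
def IsClassicalSolB (u : ℝ → ℝ → ℝ) (u0 : ℝ → ℝ) (T : ℝ) : Prop :=
  ContinuousOn (fun p : ℝ × ℝ => u p.1 p.2) (Set.Icc (-1 : ℝ) 1 ×ˢ Set.Icc (0 : ℝ) T) ∧
  ContinuousOn (fun p : ℝ × ℝ => ux u p.1 p.2) (Set.Icc (-1 : ℝ) 1 ×ˢ Set.Icc (0 : ℝ) T) ∧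
  (∀ t ∈ Set.Ioc (0 : ℝ) T, ∀ x ∈ Set.Ioo (-1 : ℝ) 1,
    DifferentiableAt ℝ (fun y => u y t) x ∧
    DifferentiableAt ℝ (fun y => ux u y t) x ∧
    DifferentiableAt ℝ (fun s => u x s) t ∧
    ut u x t = uxx u x t / (1 + ux u x t ^ 2)) ∧
  (∀ t ∈ Set.Ioc (0 : ℝ) T, ux u 1 t = u 1 t ∧ ux u (-1) t = - u (-1) t) ∧
  (∀ x ∈ Set.Icc (-1 : ℝ) 1, u x 0 = u0 x)

open Set Filter Topology

/-- First-order condition at a maximum on an interval. -/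
lemma aux_max_first {f : ℝ → ℝ} {f' a b z : ℝ} (hz : z ∈ Icc a b)
    (hf : HasDerivWithinAt f f' (Icc a b) z) (hm : ∀ y ∈ Icc a b, f y ≤ f z)
    {y : ℝ} (hy : y ∈ Icc a b) : (y - z) * f' ≤ 0 := by
  have h1 : IsLocalMaxOn f (Icc a b) z := by
    filter_upwards [self_mem_nhdsWithin] with w hw using hm w hw
  have h2 : y - z ∈ posTangentConeAt (Icc a b) z :=
    sub_mem_posTangentConeAt_of_segment_subset ((convex_Icc a b).segment_subset hz hy)
  have h3 := h1.hasFDerivWithinAt_nonpos hf.hasFDerivWithinAt h2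
  simpa using h3

/-- Second-order condition at a local maximum. -/
lemma aux_max_second {f g : ℝ → ℝ} {c : ℝ} (hf : ∀ᶠ s in 𝓝 0, HasDerivAt f (g s) s)
    (hg : HasDerivAt g c 0) (hm : IsLocalMax f 0) : c ≤ 0 := by
  by_contra hc
  push Not at hc
  have hfg : deriv f =ᶠ[𝓝 0] g := hf.mono fun s hs => hs.deriv
  have h2 : deriv (deriv f) 0 = c := by
    rw [hfg.deriv_eq]; exact hg.deriv
  have hmin : IsLocalMin f 0 :=
    isLocalMin_of_deriv_deriv_pos (by rw [h2]; exact hc) hm.deriv_eq_zero hf.self_of_nhds.continuousAt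
  have hconst : f =ᶠ[𝓝 0] fun _ => f 0 := by
    filter_upwards [hm, hmin] with s h1 h2 using le_antisymm h1 h2
  have h3 : deriv f =ᶠ[𝓝 0] fun _ => 0 := by
    have := hconst.deriv
    simpa using this
  have h4 : deriv (deriv f) 0 = 0 := by
    rw [h3.deriv_eq]; simp
  linarith

/-- Abstract Neumann problem `U_t = S² U_xx + F`. -/
structure AuxSol (S F : ℝ → ℝ → ℝ → ℝ) (R T : ℝ) (U P : ℝ → ℝ → ℝ) : Prop where
  cont : ContinuousOn (fun p : ℝ × ℝ => U p.1 p.2) (Icc (-1 : ℝ) 1 ×ˢ Icc (0 : ℝ) T)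
  bdU : ∀ x ∈ Icc (-1 : ℝ) 1, ∀ t ∈ Icc (0 : ℝ) T, |U x t| ≤ R
  bdP : ∀ x ∈ Icc (-1 : ℝ) 1, ∀ t ∈ Icc (0 : ℝ) T, |P x t| ≤ R
  lip : ∀ x ∈ Icc (-1 : ℝ) 1, ∀ y ∈ Icc (-1 : ℝ) 1, ∀ t ∈ Icc (0 : ℝ) T,
    U x t - U y t ≤ R * |x - y|
  der : ∀ x ∈ Icc (-1 : ℝ) 1, ∀ t ∈ Ioc (0 : ℝ) T,
    HasDerivWithinAt (fun y => U y t) (P x t) (Icc (-1) 1) x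
  bc1 : ∀ t ∈ Ioc (0 : ℝ) T, P 1 t = 0
  bc2 : ∀ t ∈ Ioc (0 : ℝ) T, P (-1) t = 0
  pde : ∀ x ∈ Ioo (-1 : ℝ) 1, ∀ t ∈ Ioc (0 : ℝ) T, ∃ X : ℝ,
    HasDerivAt (fun y => P y t) X x ∧
    HasDerivAt (fun s => U x s) (S x (U x t) (P x t) ^ 2 * X + F x (U x t) (P x t)) t

/-- the doubled function -/
noncomputable def auxPhi (U V : ℝ → ℝ → ℝ) (e K l t0 : ℝ) (x y t : ℝ) : ℝ :=
  U x t - V y t - ((x - y) ^ 2 / (2 * e) + e * (K + l * (t - t0) + (x ^ 2 + y ^ 2) / 2))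

/-- The second-order inequality at an interior maximum of the doubled function. -/
lemma aux_second {U V P Q : ℝ → ℝ → ℝ} {e K l t0 t x y X Y : ℝ}
    (hx : x ∈ Ioo (-1 : ℝ) 1) (hy : y ∈ Ioo (-1 : ℝ) 1)
    (hU : ∀ x ∈ Ioo (-1 : ℝ) 1, HasDerivAt (fun y => U y t) (P x t) x)
    (hV : ∀ x ∈ Ioo (-1 : ℝ) 1, HasDerivAt (fun y => V y t) (Q x t) x)
    (hX : HasDerivAt (fun y => P y t) X x) (hY : HasDerivAt (fun y => Q y t) Y y)
    (hm : ∀ x' ∈ Icc (-1 : ℝ) 1, ∀ y' ∈ Icc (-1 : ℝ) 1,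
      auxPhi U V e K l t0 x' y' t ≤ auxPhi U V e K l t0 x y t) (a b : ℝ) :
    a ^ 2 * X - b ^ 2 * Y ≤ (a - b) ^ 2 / e + e * (a ^ 2 + b ^ 2) := by
  have cx : ∀ s : ℝ, HasDerivAt (fun s => x + a * s) a s := fun s => by
    simpa using ((hasDerivAt_id s).const_mul a).const_add x
  have cy : ∀ s : ℝ, HasDerivAt (fun s => y + b * s) b s := fun s => by
    simpa using ((hasDerivAt_id s).const_mul b).const_add y
  have ex : ∀ᶠ s in 𝓝 (0 : ℝ), x + a * s ∈ Ioo (-1 : ℝ) 1 := by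
    apply (cx 0).continuousAt.eventually_mem
    simpa using Ioo_mem_nhds hx.1 hx.2
  have ey : ∀ᶠ s in 𝓝 (0 : ℝ), y + b * s ∈ Ioo (-1 : ℝ) 1 := by
    apply (cy 0).continuousAt.eventually_mem
    simpa using Ioo_mem_nhds hy.1 hy.2
  have key := aux_max_second
    (f := fun s => auxPhi U V e K l t0 (x + a * s) (y + b * s) t)
    (g := fun s => P (x + a * s) t * a - Q (y + b * s) t * b -
      ((2 * ((x + a * s) - (y + b * s)) * (a - b)) / (2 * e)
        + e * ((2 * (x + a * s) * a + 2 * (y + b * s) * b) / 2)))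
    (c := X * a * a - Y * b * b -
      ((2 * (a - b) * (a - b)) / (2 * e) + e * ((2 * a * a + 2 * b * b) / 2))) ?_ ?_ ?_
  · have : (2 * (a - b) * (a - b)) / (2 * e) = (a - b) ^ 2 / e := by
      rw [mul_assoc, mul_div_mul_left _ _ (two_ne_zero)]; ring
    rw [this] at key
    linarith
  · filter_upwards [ex, ey] with s h1 h2
    have d1 := (hU _ h1).comp s (cx s)
    have d2 := (hV _ h2).comp s (cy s)
    have d3 := ((((cx s).sub (cy s)).pow 2).div_const (2 * e))
    have d4 := (((((cx s).pow 2).add ((cy s).pow 2)).div_const 2).const_add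
      (K + l * (t - t0))).const_mul e
    have d5 := (d1.sub d2).sub (d3.add d4)
    unfold auxPhi
    refine d5.congr_deriv ?_
    simp
  · have hX' : HasDerivAt (fun y => P y t) X (x + a * 0) := by simpa using hX
    have hY' : HasDerivAt (fun x => Q x t) Y (y + b * 0) := by simpa using hY
    have d1 := (hX'.comp 0 (cx 0)).mul_const a
    have d2 := (hY'.comp 0 (cy 0)).mul_const b
    have d3 := (((((cx 0).sub (cy 0)).const_mul 2).mul_const (a - b)).div_const (2 * e))
    have d4 := ((((((cx 0).const_mul 2).mul_const a).add
      (((cy 0).const_mul 2).mul_const b)).div_const 2)).const_mul e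
    exact (d1.sub d2).sub (d3.add d4)
  · filter_upwards [ex, ey] with s h1 h2
    simpa using hm _ (Ioo_subset_Icc_self h1) _ (Ioo_subset_Icc_self h2)

set_option maxHeartbeats 1000000 in
lemma aux_strict {S F : ℝ → ℝ → ℝ → ℝ} {R T L : ℝ} {U P V Q : ℝ → ℝ → ℝ}
    (hL : 0 ≤ L) (hR : 0 ≤ R)
    (hS1 : ∀ x r p, |S x r p| ≤ 1)
    (hS : ∀ x y r s p q d : ℝ, |x| ≤ 1 → |y| ≤ 1 → |r| ≤ R → |s| ≤ R → |p| ≤ R → |q| ≤ R →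
      |x - y| ≤ d → |r - s| ≤ d → |p - q| ≤ d →
      |S x r p - S y s q| ≤ L * d ∧ |F x r p - F y s q| ≤ L * d)
    (hU : AuxSol S F R T U P) (hV : AuxSol S F R T V Q)
    {D l K e t0 t1 : ℝ} (hK : K = R ^ 2 / 2 + 1)
    (hD : D = (R + 1) ^ 2 / 2 + K + 2 + (R + 1) + 2)
    (hl : l = L ^ 2 * D ^ 2 + L * D + 3)
    (he : 0 < e) (he1 : e ≤ 1) (ht0 : 0 ≤ t0) (ht1 : t1 ≤ T) (h01 : l * (t1 - t0) ≤ 1)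
    (hini : ∀ x ∈ Icc (-1 : ℝ) 1, U x t0 ≤ V x t0) :
    ∀ x ∈ Icc (-1 : ℝ) 1, ∀ y ∈ Icc (-1 : ℝ) 1, ∀ t ∈ Icc t0 t1,
      auxPhi U V e K l t0 x y t < 0 := by
  by_contra hcon
  push Not at hcon
  obtain ⟨xc, hxc, yc, hyc, tc, htc, hc⟩ := hcon
  have hDpos : 0 < D := by rw [hD, hK]; positivity
  have hlpos : 0 < l := by rw [hl]; positivity
  -- the closed box
  set B : Set (ℝ × ℝ × ℝ) := Icc (-1 : ℝ) 1 ×ˢ Icc (-1 : ℝ) 1 ×ˢ Icc t0 t1 with hB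
  have hBc : IsCompact B := isCompact_Icc.prod (isCompact_Icc.prod isCompact_Icc)
  have hcont : ContinuousOn (fun p : ℝ × ℝ × ℝ => auxPhi U V e K l t0 p.1 p.2.1 p.2.2) B := by
    unfold auxPhi
    have c1 : ContinuousOn (fun p : ℝ × ℝ × ℝ => U p.1 p.2.2) B := by
      refine hU.cont.comp (f := fun p : ℝ × ℝ × ℝ => (p.1, p.2.2)) (by fun_prop) ?_
      rintro ⟨a, b, c⟩ ⟨h1, h2, h3⟩
      exact ⟨h1, ht0.trans h3.1, h3.2.trans ht1⟩
    have c2 : ContinuousOn (fun p : ℝ × ℝ × ℝ => V p.2.1 p.2.2) B := by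
      refine hV.cont.comp (f := fun p : ℝ × ℝ × ℝ => (p.2.1, p.2.2)) (by fun_prop) ?_
      rintro ⟨a, b, c⟩ ⟨h1, h2, h3⟩
      exact ⟨h2, ht0.trans h3.1, h3.2.trans ht1⟩
    exact (c1.sub c2).sub (by fun_prop)
  have hZc : IsCompact (B ∩ (fun p : ℝ × ℝ × ℝ => auxPhi U V e K l t0 p.1 p.2.1 p.2.2) ⁻¹' Ici 0) :=
    hBc.of_isClosed_subset (hcont.preimage_isClosed_of_isClosed hBc.isClosed isClosed_Ici)
      inter_subset_left
  obtain ⟨⟨x, y, t⟩, ⟨⟨hx, hy, ht⟩, hge⟩, hmin⟩ := hZc.exists_isMinOn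
    ⟨(xc, yc, tc), ⟨hxc, hyc, htc⟩, hc⟩ (f := fun p : ℝ × ℝ × ℝ => p.2.2) (by fun_prop)
  simp only [mem_preimage, mem_Ici] at hge hx hy ht
  -- before time `t` the function is negative
  have hbefore : ∀ x' ∈ Icc (-1 : ℝ) 1, ∀ y' ∈ Icc (-1 : ℝ) 1, ∀ s ∈ Ico t0 t,
      auxPhi U V e K l t0 x' y' s < 0 := by
    intro x' hx' y' hy' s hs
    by_contra hcc
    push Not at hcc
    have := hmin (a := (x', y', s)) ⟨⟨hx', hy', hs.1, (hs.2.le.trans ht.2)⟩, hcc⟩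
    simp only at this
    exact absurd hs.2 (not_lt.2 this)
  have habs : ∀ z ∈ Icc (-1 : ℝ) 1, |z| ≤ 1 := fun z hz => abs_le.2 hz
  -- `t > t0`
  have htpos : t0 < t := by
    rcases ht.1.lt_or_eq with h | h
    · exact h
    · exfalso
      subst h
      have hT0 : t0 ∈ Icc (0 : ℝ) T := ⟨ht0, ht.2.trans ht1⟩
      have h1 := hU.lip x hx y hy t0 hT0
      have h2 := hini y hy
      unfold auxPhi at hge
      have h3 : R * |x - y| ≤ (x - y) ^ 2 / (2 * e) + e * (R ^ 2 / 2) := by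
        have : (x - y) ^ 2 / (2 * e) + e * (R ^ 2 / 2) - R * |x - y|
            = (|x - y| - e * R) ^ 2 / (2 * e) := by
          rw [← sq_abs (x - y)]; field_simp; ring
        have : 0 ≤ (|x - y| - e * R) ^ 2 / (2 * e) := by positivity
        linarith
      rw [hK] at hge
      nlinarith [mul_nonneg he.le (sq_nonneg x), mul_nonneg he.le (sq_nonneg y)]
  have htT : t ∈ Ioc (0 : ℝ) T := ⟨ht0.trans_lt htpos, ht.2.trans ht1⟩
  have htT' : t ∈ Icc (0 : ℝ) T := Ioc_subset_Icc_self htT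
  -- at time `t` the function is nonpositive
  have hnow : ∀ x' ∈ Icc (-1 : ℝ) 1, ∀ y' ∈ Icc (-1 : ℝ) 1,
      auxPhi U V e K l t0 x' y' t ≤ 0 := by
    intro x' hx' y' hy'
    have hct : ContinuousWithinAt (fun s => auxPhi U V e K l t0 x' y' s) (Icc t0 t1) t := by
      have := hcont (x', y', t) ⟨hx', hy', ht⟩
      exact this.comp (f := fun s : ℝ => (x', y', s)) (by fun_prop) (fun s hs => ⟨hx', hy', hs⟩)
    have hne : (𝓝[Ico t0 t] t).NeBot := by
      rw [← mem_closure_iff_nhdsWithin_neBot, closure_Ico htpos.ne]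
      exact ⟨htpos.le, le_rfl⟩
    have h2 := hct.mono (s := Ico t0 t) (fun s hs => ⟨hs.1, hs.2.le.trans ht.2⟩)
    refine le_of_tendsto h2 ?_
    filter_upwards [self_mem_nhdsWithin] with s hs using (hbefore x' hx' y' hy' s hs).le
  have hzero : auxPhi U V e K l t0 x y t = 0 := le_antisymm (hnow x hx y hy) hge
  have hmax : ∀ x' ∈ Icc (-1 : ℝ) 1, ∀ y' ∈ Icc (-1 : ℝ) 1,
      auxPhi U V e K l t0 x' y' t ≤ auxPhi U V e K l t0 x y t := by
    rw [hzero]; exact hnow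
  -- first-order conditions
  have hfx : ∀ z ∈ Icc (-1 : ℝ) 1, (z - x) * (P x t - ((x - y) / e + e * x)) ≤ 0 := by
    intro z hz
    refine aux_max_first (f := fun x' => auxPhi U V e K l t0 x' y t) hx ?_
      (fun x' hx' => hmax x' hx' y hy) hz
    have i := hasDerivWithinAt_id x (Icc (-1 : ℝ) 1)
    have d := ((hU.der x hx t htT).sub_const (V y t)).sub
      ((((i.sub_const y).pow 2).div_const (2 * e)).add
        (((((i.pow 2).add_const (y ^ 2)).div_const 2).const_add (K + l * (t - t0))).const_mul e))
    unfold auxPhi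
    refine d.congr_deriv ?_
    simp
    field_simp
  have hfy : ∀ z ∈ Icc (-1 : ℝ) 1, (z - y) * (-Q y t + (x - y) / e - e * y) ≤ 0 := by
    intro z hz
    refine aux_max_first (f := fun y' => auxPhi U V e K l t0 x y' t) hy ?_
      (fun y' hy' => hmax x hx y' hy') hz
    have i := hasDerivWithinAt_id y (Icc (-1 : ℝ) 1)
    have d := ((hV.der y hy t htT).const_sub (U x t)).sub
      ((((i.const_sub x).pow 2).div_const (2 * e)).add
        (((((i.pow 2).const_add (x ^ 2)).div_const 2).const_add (K + l * (t - t0))).const_mul e))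
    unfold auxPhi
    refine d.congr_deriv ?_
    simp
    field_simp
    ring
  have m1 : (1 : ℝ) ∈ Icc (-1 : ℝ) 1 := by constructor <;> norm_num
  have m2 : (-1 : ℝ) ∈ Icc (-1 : ℝ) 1 := by constructor <;> norm_num
  -- boundary excluded
  have hx1 : x ≠ 1 := by
    rintro rfl
    have h := hfx (-1) m2
    rw [hU.bc1 t htT] at h
    have : 0 ≤ (1 - y) / e := div_nonneg (by linarith [hy.2]) he.le
    nlinarith
  have hx2 : x ≠ -1 := by
    rintro rfl
    have h := hfx 1 m1
    rw [hU.bc2 t htT] at h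
    have : (-1 - y) / e ≤ 0 := div_nonpos_of_nonpos_of_nonneg (by linarith [hy.1]) he.le
    nlinarith
  have hy1 : y ≠ 1 := by
    rintro rfl
    have h := hfy (-1) m2
    rw [hV.bc1 t htT] at h
    have : (x - 1) / e ≤ 0 := div_nonpos_of_nonpos_of_nonneg (by linarith [hx.2]) he.le
    nlinarith
  have hy2 : y ≠ -1 := by
    rintro rfl
    have h := hfy 1 m1
    rw [hV.bc2 t htT] at h
    have : 0 ≤ (x - -1) / e := div_nonneg (by linarith [hx.1]) he.le
    nlinarith
  have hxo : x ∈ Ioo (-1 : ℝ) 1 := ⟨lt_of_le_of_ne hx.1 hx2.symm, lt_of_le_of_ne hx.2 hx1⟩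
  have hyo : y ∈ Ioo (-1 : ℝ) 1 := ⟨lt_of_le_of_ne hy.1 hy2.symm, lt_of_le_of_ne hy.2 hy1⟩
  have hp : P x t = (x - y) / e + e * x := by
    have h1 := hfx 1 m1
    have h2 := hfx (-1) m2
    have a1 : 0 < 1 - x := by linarith [hxo.2]
    have a2 : -1 - x < 0 := by linarith [hxo.1]
    have b1 := nonpos_of_mul_nonpos_right h1 a1
    have b2 : 0 ≤ P x t - ((x - y) / e + e * x) := by
      by_contra hb
      push Not at hb
      exact absurd h2 (not_le.2 (mul_pos_of_neg_of_neg a2 hb))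
    linarith
  have hq : Q y t = (x - y) / e - e * y := by
    have h1 := hfy 1 m1
    have h2 := hfy (-1) m2
    have a1 : 0 < 1 - y := by linarith [hyo.2]
    have a2 : -1 - y < 0 := by linarith [hyo.1]
    have b1 := nonpos_of_mul_nonpos_right h1 a1
    have b2 : 0 ≤ -Q y t + (x - y) / e - e * y := by
      by_contra hb
      push Not at hb
      exact absurd h2 (not_le.2 (mul_pos_of_neg_of_neg a2 hb))
    linarith
  obtain ⟨X, hX, hXt⟩ := hU.pde x hxo t htT
  obtain ⟨Y, hY, hYt⟩ := hV.pde y hyo t htT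
  -- second-order condition
  have hsec := aux_second (P := P) (Q := Q) hxo hyo
    (fun z hz => (hU.der z (Ioo_subset_Icc_self hz) t htT).hasDerivAt (Icc_mem_nhds hz.1 hz.2))
    (fun z hz => (hV.der z (Ioo_subset_Icc_self hz) t htT).hasDerivAt (Icc_mem_nhds hz.1 hz.2))
    hX hY hmax (S x (U x t) (P x t)) (S y (V y t) (Q y t))
  -- time condition
  have htime : l * e ≤ (S x (U x t) (P x t) ^ 2 * X + F x (U x t) (P x t))
      - (S y (V y t) (Q y t) ^ 2 * Y + F y (V y t) (Q y t)) := by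
    have d := (hXt.sub hYt).sub
      (((((((hasDerivAt_id t).sub_const t0).const_mul l).const_add K).add_const
        ((x ^ 2 + y ^ 2) / 2)).const_mul e).const_add ((x - y) ^ 2 / (2 * e)))
    have h := aux_max_first (f := fun s => auxPhi U V e K l t0 x y s) (a := t0) (b := t)
      (z := t) ⟨htpos.le, le_rfl⟩ (by unfold auxPhi; exact d.hasDerivWithinAt) ?_
      (y := t0) ⟨le_rfl, htpos.le⟩
    · have : 0 < t - t0 := by linarith
      have h' := le_of_not_gt (fun hneg => absurd h (not_le.2 (mul_pos_of_neg_of_neg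
        (by linarith : t0 - t < 0) hneg)))
      linarith
    · intro s hs
      rcases hs.2.lt_or_eq with h | h
      · simp only [hzero]
        exact (hbefore x hx y hy s ⟨hs.1, h⟩).le
      · rw [h]
  -- estimates
  have ax := habs x hx
  have ay := habs y hy
  have bP := hU.bdP x hx t htT'
  have bQ := hV.bdP y hy t htT'
  have hxy : |x - y| ≤ e * (R + 1) := by
    have h1 : x - y = e * (P x t - e * x) := by rw [hp]; field_simp; ring
    rw [h1, abs_mul, abs_of_pos he]
    refine mul_le_mul_of_nonneg_left ?_ he.le
    refine (abs_sub _ _).trans ?_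
    rw [abs_mul, abs_of_pos he]
    have : e * |x| ≤ 1 * 1 := mul_le_mul he1 ax (abs_nonneg x) zero_le_one
    linarith
  have hpq : |P x t - Q y t| ≤ e * 2 := by
    have h1 : P x t - Q y t = e * (x + y) := by rw [hp, hq]; ring
    rw [h1, abs_mul, abs_of_pos he]
    refine mul_le_mul_of_nonneg_left ?_ he.le
    exact (abs_add_le _ _).trans (by linarith)
  have hsq : (x - y) ^ 2 / (2 * e) ≤ e * ((R + 1) ^ 2 / 2) := by
    rw [div_le_iff₀ (by positivity), ← sq_abs]
    calc |x - y| ^ 2 ≤ (e * (R + 1)) ^ 2 := by gcongr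
      _ = _ := by ring
  have hK0 : 0 ≤ K := by rw [hK]; positivity
  have hlt : l * (t - t0) ≤ 1 :=
    (mul_le_mul_of_nonneg_left (by linarith [ht.2]) hlpos.le).trans h01
  have hlt0 : 0 ≤ l * (t - t0) := mul_nonneg hlpos.le (by linarith)
  have hrs : |U x t - V y t| ≤ e * ((R + 1) ^ 2 / 2 + K + 2) := by
    have h1 : U x t - V y t =
        (x - y) ^ 2 / (2 * e) + e * (K + l * (t - t0) + (x ^ 2 + y ^ 2) / 2) := by
      unfold auxPhi at hzero; linarith
    have x2 : x ^ 2 ≤ 1 := (sq_le_one_iff_abs_le_one x).2 ax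
    have y2 : y ^ 2 ≤ 1 := (sq_le_one_iff_abs_le_one y).2 ay
    rw [h1, abs_of_nonneg (by positivity)]
    have : e * (K + l * (t - t0) + (x ^ 2 + y ^ 2) / 2) ≤ e * (K + 2) :=
      mul_le_mul_of_nonneg_left (by linarith) he.le
    linarith
  have hR1 : 0 ≤ (R + 1) ^ 2 / 2 := by positivity
  obtain ⟨hs1, hf1⟩ := hS x y (U x t) (V y t) (P x t) (Q y t) (e * D) ax ay
    (hU.bdU x hx t htT') (hV.bdU y hy t htT') bP bQ
    (hxy.trans (mul_le_mul_of_nonneg_left (by linarith) he.le))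
    (hrs.trans (mul_le_mul_of_nonneg_left (by linarith) he.le))
    (hpq.trans (mul_le_mul_of_nonneg_left (by linarith) he.le))
  have hs2 := hS1 x (U x t) (P x t)
  have hs3 := hS1 y (V y t) (Q y t)
  generalize S x (U x t) (P x t) = s1 at *
  generalize S y (V y t) (Q y t) = s2 at *
  have e1 : s1 ^ 2 ≤ 1 := (sq_le_one_iff_abs_le_one s1).2 hs2
  have e2 : s2 ^ 2 ≤ 1 := (sq_le_one_iff_abs_le_one s2).2 hs3
  have e3 : (s1 - s2) ^ 2 / e ≤ e * (L ^ 2 * D ^ 2) := by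
    rw [div_le_iff₀ he, ← sq_abs]
    calc |s1 - s2| ^ 2 ≤ (L * (e * D)) ^ 2 := by gcongr
      _ = _ := by ring
  have e4 := (abs_le.1 hf1).2
  have e5 : e * (s1 ^ 2 + s2 ^ 2) ≤ e * 2 := mul_le_mul_of_nonneg_left (by linarith) he.le
  have e6 : l * e = e * (L ^ 2 * D ^ 2) + L * (e * D) + 3 * e := by rw [hl]; ring
  linarith

lemma aux_step {S F : ℝ → ℝ → ℝ → ℝ} {R T L : ℝ}
    (hL : 0 ≤ L) (hR : 0 ≤ R)
    (hS1 : ∀ x r p, |S x r p| ≤ 1)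
    (hS : ∀ x y r s p q d : ℝ, |x| ≤ 1 → |y| ≤ 1 → |r| ≤ R → |s| ≤ R → |p| ≤ R → |q| ≤ R →
      |x - y| ≤ d → |r - s| ≤ d → |p - q| ≤ d →
      |S x r p - S y s q| ≤ L * d ∧ |F x r p - F y s q| ≤ L * d) :
    ∃ h > 0, ∀ U P V Q : ℝ → ℝ → ℝ, AuxSol S F R T U P → AuxSol S F R T V Q →
      ∀ t0, 0 ≤ t0 → (∀ x ∈ Icc (-1 : ℝ) 1, U x t0 ≤ V x t0) →
      ∀ t, t0 ≤ t → t ≤ T → t ≤ t0 + h → ∀ x ∈ Icc (-1 : ℝ) 1, U x t ≤ V x t := by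
  obtain ⟨K, hK⟩ : ∃ K, K = R ^ 2 / 2 + 1 := ⟨_, rfl⟩
  obtain ⟨D, hD⟩ : ∃ D, D = (R + 1) ^ 2 / 2 + K + 2 + (R + 1) + 2 := ⟨_, rfl⟩
  obtain ⟨l, hl⟩ : ∃ l, l = L ^ 2 * D ^ 2 + L * D + 3 := ⟨_, rfl⟩
  have hDpos : 0 < D := by rw [hD, hK]; positivity
  have hlpos : 0 < l := by rw [hl]; positivity
  refine ⟨1 / l, by positivity, ?_⟩
  intro U P V Q hU hV t0 ht0 hini t htt htT hth x hx
  have hlt : l * (t - t0) ≤ 1 := by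
    have : t - t0 ≤ 1 / l := by linarith
    calc l * (t - t0) ≤ l * (1 / l) := by gcongr
      _ = 1 := by field_simp
  have key : ∀ e ∈ Ioc (0 : ℝ) 1, U x t - V x t ≤ e * (K + 2) := by
    intro e he
    have h := aux_strict hL hR hS1 hS hU hV hK hD hl he.1 he.2 ht0 htT hlt hini x hx x hx t
      ⟨htt, le_rfl⟩
    unfold auxPhi at h
    have x2 : x ^ 2 ≤ 1 := by nlinarith [hx.1, hx.2]
    have : e * (K + l * (t - t0) + (x ^ 2 + x ^ 2) / 2) ≤ e * (K + 2) :=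
      mul_le_mul_of_nonneg_left (by linarith) he.1.le
    have h0 : (x - x) ^ 2 / (2 * e) = 0 := by simp
    linarith
  have hlim : Tendsto (fun e : ℝ => e * (K + 2)) (𝓝[>] 0) (𝓝 0) := by
    have : Tendsto (fun e : ℝ => e * (K + 2)) (𝓝 0) (𝓝 (0 * (K + 2))) :=
      (continuous_id.mul continuous_const).tendsto _
    rw [zero_mul] at this
    exact this.mono_left nhdsWithin_le_nhds
  have := ge_of_tendsto hlim (by
    filter_upwards [Ioc_mem_nhdsGT (zero_lt_one' ℝ)] with e he using key e he)
  linarith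

noncomputable def auxS (x r p : ℝ) : ℝ := 1 / √(1 + ((1 + x ^ 2) * p + 2 * x * r) ^ 2)

noncomputable def auxF (x r p : ℝ) : ℝ :=
  (4 * x * p + 2 * r) / (1 + x ^ 2) / (1 + ((1 + x ^ 2) * p + 2 * x * r) ^ 2)

lemma auxS_le (x r p : ℝ) : |auxS x r p| ≤ 1 := by
  unfold auxS
  have h : 1 ≤ √(1 + ((1 + x ^ 2) * p + 2 * x * r) ^ 2) := by
    rw [Real.one_le_sqrt]; nlinarith [sq_nonneg ((1 + x ^ 2) * p + 2 * x * r)]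
  rw [abs_of_nonneg (by positivity)]
  rw [div_le_one (by linarith)]
  exact h

lemma auxSF_lip (R : ℝ) : ∃ L : ℝ, 0 ≤ L ∧ ∀ x y r s p q d : ℝ, |x| ≤ 1 → |y| ≤ 1 →
    |r| ≤ R → |s| ≤ R → |p| ≤ R → |q| ≤ R → |x - y| ≤ d → |r - s| ≤ d → |p - q| ≤ d →
      |auxS x r p - auxS y s q| ≤ L * d ∧ |auxF x r p - auxF y s q| ≤ L * d := by
  set B : Set (ℝ × ℝ × ℝ) := Icc (-1 : ℝ) 1 ×ˢ Icc (-R) R ×ˢ Icc (-R) R with hB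
  have hBc : IsCompact B := isCompact_Icc.prod (isCompact_Icc.prod isCompact_Icc)
  have hBv : Convex ℝ B := (convex_Icc _ _).prod ((convex_Icc _ _).prod (convex_Icc _ _))
  have c1 : ContDiff ℝ 1 (fun z : ℝ × ℝ × ℝ => auxS z.1 z.2.1 z.2.2) := by
    unfold auxS
    refine ContDiff.div contDiff_const (ContDiff.sqrt (by fun_prop) ?_) ?_
    · intro z; positivity
    · intro z; positivity
  have c2 : ContDiff ℝ 1 (fun z : ℝ × ℝ × ℝ => auxF z.1 z.2.1 z.2.2) := by
    unfold auxF
    refine ContDiff.div (ContDiff.div (by fun_prop) (by fun_prop) ?_) (by fun_prop) ?_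
    · intro z; positivity
    · intro z; positivity
  obtain ⟨L1, h1⟩ := c1.contDiffOn.exists_lipschitzOnWith one_ne_zero hBv hBc
  obtain ⟨L2, h2⟩ := c2.contDiffOn.exists_lipschitzOnWith one_ne_zero hBv hBc
  refine ⟨max L1 L2, le_max_of_le_left L1.2, ?_⟩
  intro x y r s p q d hx hy hr hs hp hq hxy hrs hpq
  have m1 : (x, r, p) ∈ B := ⟨abs_le.1 hx, abs_le.1 hr, abs_le.1 hp⟩
  have m2 : (y, s, q) ∈ B := ⟨abs_le.1 hy, abs_le.1 hs, abs_le.1 hq⟩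
  have hd : dist (x, r, p) (y, s, q) ≤ d := by
    simp only [Prod.dist_eq, Real.dist_eq]
    exact max_le hxy (max_le hrs hpq)
  have hd0 : 0 ≤ d := (abs_nonneg _).trans hxy
  have g1 := h1.dist_le_mul _ m1 _ m2
  have g2 := h2.dist_le_mul _ m1 _ m2
  simp only [Real.dist_eq] at g1 g2
  constructor
  · exact g1.trans (mul_le_mul (le_max_left _ _) hd dist_nonneg (le_max_of_le_left L1.2))
  · exact g2.trans (mul_le_mul (le_max_right _ _) hd dist_nonneg (le_max_of_le_left L1.2))

noncomputable def auxU (u : ℝ → ℝ → ℝ) (x t : ℝ) : ℝ := u x t / (1 + x ^ 2)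

noncomputable def auxP (u : ℝ → ℝ → ℝ) (x t : ℝ) : ℝ :=
  (ux u x t * (1 + x ^ 2) - u x t * (2 * x)) / (1 + x ^ 2) ^ 2

lemma aux_der_b (x : ℝ) : HasDerivAt (fun x : ℝ => 1 + x ^ 2) (2 * x) x := by
  simpa using ((hasDerivAt_id x).pow 2).const_add 1

lemma aux_one_sided {u : ℝ → ℝ → ℝ} {u0 : ℝ → ℝ} {T : ℝ} (hu : IsClassicalSolB u u0 T)
    {x t : ℝ} (hx : x ∈ Icc (-1 : ℝ) 1) (ht : t ∈ Ioc (0 : ℝ) T) :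
    HasDerivWithinAt (fun y => u y t) (ux u x t) (Icc (-1) 1) x := by
  obtain ⟨hc, hcx, hd, -, -⟩ := hu
  have ht' : t ∈ Icc (0 : ℝ) T := Ioc_subset_Icc_self ht
  have k1 : ContinuousOn (fun y => u y t) (Icc (-1 : ℝ) 1) :=
    hc.comp (f := fun y : ℝ => (y, t)) (by fun_prop) (fun y hy => ⟨hy, ht'⟩)
  have k2 : ContinuousOn (fun y => ux u y t) (Icc (-1 : ℝ) 1) :=
    hcx.comp (f := fun y : ℝ => (y, t)) (by fun_prop) (fun y hy => ⟨hy, ht'⟩)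
  have k3 : DifferentiableOn ℝ (fun y => u y t) (Ioo (-1 : ℝ) 1) :=
    fun y hy => (hd t ht y hy).1.differentiableWithinAt
  rcases hx.1.eq_or_lt with h | h
  · subst h
    refine (hasDerivWithinAt_Ici_of_tendsto_deriv k3
      ((k1 _ hx).mono Ioo_subset_Icc_self) (Ioo_mem_nhdsGT (by norm_num)) ?_).mono
      Icc_subset_Ici_self
    have := (k2 _ hx).mono (s := Ioo (-1 : ℝ) 1) Ioo_subset_Icc_self
    rw [ContinuousWithinAt, nhdsWithin_Ioo_eq_nhdsGT (by norm_num)] at this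
    exact this
  rcases hx.2.eq_or_lt with h' | h'
  · subst h'
    refine (hasDerivWithinAt_Iic_of_tendsto_deriv k3
      ((k1 _ hx).mono Ioo_subset_Icc_self) (Ioo_mem_nhdsLT (by norm_num)) ?_).mono
      Icc_subset_Iic_self
    have := (k2 _ hx).mono (s := Ioo (-1 : ℝ) 1) Ioo_subset_Icc_self
    rw [ContinuousWithinAt, nhdsWithin_Ioo_eq_nhdsLT (by norm_num)] at this
    exact this
  · exact (hd t ht x ⟨h, h'⟩).1.hasDerivAt.hasDerivWithinAt

lemma aux_sol {u : ℝ → ℝ → ℝ} {u0 : ℝ → ℝ} {T : ℝ} (hT : 0 < T) (hu : IsClassicalSolB u u0 T) :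
    ∃ R0 : ℝ, ∀ R, R0 ≤ R → AuxSol auxS auxF R T (auxU u) (auxP u) := by
  have hu' := hu
  obtain ⟨hc, hcx, hd, hbc, -⟩ := hu'
  have hK : IsCompact (Icc (-1 : ℝ) 1 ×ˢ Icc (0 : ℝ) T) := isCompact_Icc.prod isCompact_Icc
  have cU : ContinuousOn (fun p : ℝ × ℝ => auxU u p.1 p.2)
      (Icc (-1 : ℝ) 1 ×ˢ Icc (0 : ℝ) T) := by
    unfold auxU
    exact hc.div (by fun_prop) (fun p _ => by positivity)
  have cP : ContinuousOn (fun p : ℝ × ℝ => auxP u p.1 p.2)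
      (Icc (-1 : ℝ) 1 ×ˢ Icc (0 : ℝ) T) := by
    unfold auxP
    exact ((hcx.mul (by fun_prop)).sub (hc.mul (by fun_prop))).div (by fun_prop)
      (fun p _ => by positivity)
  obtain ⟨R1, hR1⟩ := hK.exists_bound_of_continuousOn cU
  obtain ⟨R2, hR2⟩ := hK.exists_bound_of_continuousOn cP
  have hder : ∀ x ∈ Icc (-1 : ℝ) 1, ∀ t ∈ Ioc (0 : ℝ) T,
      HasDerivWithinAt (fun y => auxU u y t) (auxP u x t) (Icc (-1) 1) x := by
    intro x hx t ht
    exact (aux_one_sided hu hx ht).div (aux_der_b x).hasDerivWithinAt (by positivity)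
  refine ⟨max R1 R2, fun R hR => ?_⟩
  have bU : ∀ x ∈ Icc (-1 : ℝ) 1, ∀ t ∈ Icc (0 : ℝ) T, |auxU u x t| ≤ R := fun x hx t ht =>
    (hR1 (x, t) ⟨hx, ht⟩).trans ((le_max_left _ _).trans hR)
  have bP : ∀ x ∈ Icc (-1 : ℝ) 1, ∀ t ∈ Icc (0 : ℝ) T, |auxP u x t| ≤ R := fun x hx t ht =>
    (hR2 (x, t) ⟨hx, ht⟩).trans ((le_max_right _ _).trans hR)
  have lip : ∀ x ∈ Icc (-1 : ℝ) 1, ∀ y ∈ Icc (-1 : ℝ) 1, ∀ t ∈ Ioc (0 : ℝ) T,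
      auxU u x t - auxU u y t ≤ R * |x - y| := by
    intro x hx y hy t ht
    have := (convex_Icc (-1 : ℝ) 1).norm_image_sub_le_of_norm_hasDerivWithin_le
      (f := fun y => auxU u y t) (f' := fun x => auxP u x t) (C := R)
      (fun z hz => hder z hz t ht) (fun z hz => bP z hz t (Ioc_subset_Icc_self ht)) hy hx
    exact (le_abs_self _).trans this
  refine ⟨cU, bU, bP, ?_, hder, ?_, ?_, ?_⟩
  · intro x hx y hy t ht
    rcases ht.1.eq_or_lt with h | h
    · have ct : ∀ z ∈ Icc (-1 : ℝ) 1,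
          ContinuousWithinAt (fun s => auxU u z s) (Ioc 0 T) t := fun z hz =>
        ((cU (z, t) ⟨hz, ht⟩).comp (f := fun s : ℝ => (z, s)) (s := Icc 0 T)
          (by fun_prop) (fun s hs => ⟨hz, hs⟩)).mono Ioc_subset_Icc_self
      have hne : (𝓝[Ioc 0 T] t).NeBot := by
        rw [← mem_closure_iff_nhdsWithin_neBot, closure_Ioc hT.ne]
        exact ht
      refine le_of_tendsto ((ct x hx).sub (ct y hy)) ?_
      filter_upwards [self_mem_nhdsWithin] with s hs using lip x hx y hy s hs
    · exact lip x hx y hy t ⟨h, ht.2⟩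
  · intro t ht
    unfold auxP
    rw [(hbc t ht).1]; ring
  · intro t ht
    unfold auxP
    rw [(hbc t ht).2]; ring
  · intro x hx t ht
    obtain ⟨d1, d2, d3, d4⟩ := hd t ht x hx
    have h1 : HasDerivAt (fun y => u y t) (ux u x t) x := d1.hasDerivAt
    have h2 : HasDerivAt (fun y => ux u y t) (uxx u x t) x := d2.hasDerivAt
    have h3 : HasDerivAt (fun s => u x s) (ut u x t) t := d3.hasDerivAt
    have hb : (1 + x ^ 2 : ℝ) ≠ 0 := by positivity
    refine ⟨(uxx u x t - 4 * x * auxP u x t - 2 * auxU u x t) / (1 + x ^ 2), ?_, ?_⟩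
    · have h4 := ((h2.mul (aux_der_b x)).sub (h1.mul ((hasDerivAt_id x).const_mul 2))).div
        ((aux_der_b x).pow 2) (pow_ne_zero 2 hb)
      refine h4.congr_deriv ?_
      unfold auxP auxU
      simp
      field_simp
      ring
    · refine (h3.div_const (1 + x ^ 2)).congr_deriv ?_
      have hq : (1 + x ^ 2) * auxP u x t + 2 * x * auxU u x t = ux u x t := by
        unfold auxP auxU
        field_simp
        ring
      unfold auxS auxF
      rw [hq, d4, div_pow, Real.sq_sqrt (by positivity)]
      have : (1 + ux u x t ^ 2 : ℝ) ≠ 0 := by positivity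
      field_simp
      ring

/-- uniqueness. Two classical solutions of problem (B) on
`[-1,1] × [0,T]` with the same initial data `u0 ∈ C¹([-1,1])` coincide. -/
theorem stmt_3 (T : ℝ) (hT : 0 < T) (u0 : ℝ → ℝ)
    (hu0 : ContDiffOn ℝ 1 u0 (Set.Icc (-1 : ℝ) 1))
    (u v : ℝ → ℝ → ℝ)
    (hu : IsClassicalSolB u u0 T) (hv : IsClassicalSolB v u0 T) :
    ∀ x ∈ Set.Icc (-1 : ℝ) 1, ∀ t ∈ Set.Icc (0 : ℝ) T, u x t = v x t := by
  obtain ⟨R1, hR1⟩ := aux_sol hT hu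
  obtain ⟨R2, hR2⟩ := aux_sol hT hv
  have hU := hR1 (max 0 (max R1 R2)) (le_max_of_le_right (le_max_left _ _))
  have hV := hR2 (max 0 (max R1 R2)) (le_max_of_le_right (le_max_right _ _))
  obtain ⟨L, hL, hlip⟩ := auxSF_lip (max 0 (max R1 R2))
  obtain ⟨h, hh, hstep⟩ := aux_step (T := T) hL (le_max_left _ _) auxS_le hlip
  have main : ∀ n : ℕ, ∀ t ∈ Icc (0 : ℝ) T, t ≤ n * h → ∀ x ∈ Icc (-1 : ℝ) 1,
      auxU u x t = auxU v x t := by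
    intro n
    induction n with
    | zero =>
      intro t ht htn x hx
      have : t = 0 := le_antisymm (by simpa using htn) ht.1
      subst this
      unfold auxU
      rw [hu.2.2.2.2 x hx, hv.2.2.2.2 x hx]
    | succ n ih =>
      intro t ht htn x hx
      push_cast at htn
      by_cases hle : t ≤ n * h
      · exact ih t ht hle x hx
      · push Not at hle
        have h0 : 0 ≤ (n : ℝ) * h := by positivity
        have hT0 : (n : ℝ) * h ∈ Icc (0 : ℝ) T := ⟨h0, hle.le.trans ht.2⟩
        have e := ih _ hT0 le_rfl
        exact le_antisymm
          (hstep _ _ _ _ hU hV _ h0 (fun z hz => (e z hz).le) t hle.le ht.2 (by linarith) x hx)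
          (hstep _ _ _ _ hV hU _ h0 (fun z hz => (e z hz).ge) t hle.le ht.2 (by linarith) x hx)
  intro x hx t ht
  obtain ⟨n, hn⟩ := exists_nat_ge (t / h)
  have e := main n t ht (by rwa [div_le_iff₀ hh] at hn) x hx
  unfold auxU at e
  have hb : (1 + x ^ 2 : ℝ) ≠ 0 := by positivity
  exact (div_left_inj' hb).1 e
end
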